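/- For every T > 0, M ≥ 1 and ε ∈ (0,1] there exists a constant C > 0, depending only on M, ε and T, such that every smooth solution (v,u,θ,q) of the radiation hydrodynamics system on [0,T] with (M,ε)-bounded initial data satisfies v(t,x) ≥ C for all (t,x) ∈ [0,T] × 𝕋. -/

import Mathlib

open MeasureTheory Real Set

noncomputable section

namespace RadHydro

/-- Integral over one period `[-1/2, 1/2]` of the torus `𝕋 ≅ ℝ/ℤ`. -/
def tInt (f : ℝ → ℝ) : ℝ := ∫ x in (-(1/2) : ℝ)..(1/2 : ℝ), f x

/-- Squared `L²` norm over the torus. -/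
def L2sq (f : ℝ → ℝ) : ℝ := tInt fun x => (f x) ^ 2

/-- `L^∞` norm over the torus. -/
def Linf (f : ℝ → ℝ) : ℝ := sSup ((fun x => |f x|) '' Icc (-(1/2) : ℝ) (1/2))

/-- Squared `H¹` norm over the torus. -/
def H1sq (f : ℝ → ℝ) : ℝ := L2sq f + L2sq (deriv f)

/-- Squared `H²` norm over the torus. -/
def H2sq (f : ℝ → ℝ) : ℝ := L2sq f + L2sq (deriv f) + L2sq (deriv (deriv f))

/-- Partial derivative in the time variable. -/
def pt (f : ℝ → ℝ → ℝ) (t x : ℝ) : ℝ := deriv (fun s => f s x) t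

/-- Partial derivative in the space variable. -/
def px (f : ℝ → ℝ → ℝ) (t x : ℝ) : ℝ := deriv (f t) x

/-- The heat conductivity `κ(v, θ) = κ₁ + κ₂ v θ^β`. -/
def kappa (κ₁ κ₂ β v θ : ℝ) : ℝ := κ₁ + κ₂ * v * θ ^ β

/-- A smooth solution of the radiation hydrodynamics system (in Lagrangian
coordinates) on `[0, T]`: four `C^∞` functions on `[0,T] × ℝ` (modelled as smooth
functions on all of `ℝ × ℝ`), `1`-periodic in the space variable, with `v > 0`,
`θ > 0`, satisfying the four equations pointwise for `t ∈ [0, T]`, and with the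
normalization `∫_𝕋 v(0, x) dx = 1`. -/
structure Sol (μ R a b κ₁ κ₂ β γ T : ℝ) where
  v : ℝ → ℝ → ℝ
  u : ℝ → ℝ → ℝ
  θ : ℝ → ℝ → ℝ
  q : ℝ → ℝ → ℝ
  smooth_v : ContDiff ℝ (⊤ : ℕ∞) fun p : ℝ × ℝ => v p.1 p.2
  smooth_u : ContDiff ℝ (⊤ : ℕ∞) fun p : ℝ × ℝ => u p.1 p.2
  smooth_θ : ContDiff ℝ (⊤ : ℕ∞) fun p : ℝ × ℝ => θ p.1 p.2
  smooth_q : ContDiff ℝ (⊤ : ℕ∞) fun p : ℝ × ℝ => q p.1 p.2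
  periodic_v : ∀ t, Function.Periodic (v t) 1
  periodic_u : ∀ t, Function.Periodic (u t) 1
  periodic_θ : ∀ t, Function.Periodic (θ t) 1
  periodic_q : ∀ t, Function.Periodic (q t) 1
  v_pos : ∀ t x, 0 < v t x
  θ_pos : ∀ t x, 0 < θ t x
  eq_mass : ∀ t ∈ Icc (0 : ℝ) T, ∀ x : ℝ, pt v t x - px u t x = 0
  eq_mom : ∀ t ∈ Icc (0 : ℝ) T, ∀ x : ℝ,
    pt u t x + px (fun s y => R * θ s y / v s y) t x
      = px (fun s y => μ * px u s y / v s y) t x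
  eq_energy : ∀ t ∈ Icc (0 : ℝ) T, ∀ x : ℝ,
    pt (fun s y => R / (γ - 1) * θ s y + (u s y) ^ 2 / 2) t x
      + px (fun s y => R * θ s y / v s y * u s y) t x + px q t x
      = px (fun s y => μ * u s y * px u s y / v s y) t x
        + px (fun s y => kappa κ₁ κ₂ β (v s y) (θ s y) * px θ s y / v s y) t x
  eq_rad : ∀ t ∈ Icc (0 : ℝ) T, ∀ x : ℝ,
    -px (fun s y => px q s y / v s y) t x + a * v t x * q t x
      + b * px (fun s y => (θ s y) ^ 4) t x = 0
  mean_v : tInt (v 0) = 1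

/-- `(M, ε)`-bounded initial data: `‖(v₀, u₀, θ₀)‖_{H²} ≤ M` and `v₀ ≥ ε`, `θ₀ ≥ ε`. -/
def DataBounded (M ε : ℝ) (v₀ u₀ θ₀ : ℝ → ℝ) : Prop :=
  Real.sqrt (H2sq v₀ + H2sq u₀ + H2sq θ₀) ≤ M ∧ (∀ x, ε ≤ v₀ x) ∧ ∀ x, ε ≤ θ₀ x

variable {μ R a b κ₁ κ₂ β γ T : ℝ}

/-- A solution has `(M, ε)`-bounded initial data. -/
def Sol.Bounded (S : Sol μ R a b κ₁ κ₂ β γ T) (M ε : ℝ) : Prop :=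
  DataBounded M ε (S.v 0) (S.u 0) (S.θ 0)

/-- The auxiliary function `𝔛(t) = ∫₀ᵗ ∫_𝕋 κ(v,θ) θ_t² / v dx ds`. -/
def Sol.X (S : Sol μ R a b κ₁ κ₂ β γ T) (t : ℝ) : ℝ :=
  ∫ s in (0 : ℝ)..t, tInt fun x =>
    kappa κ₁ κ₂ β (S.v s x) (S.θ s x) * (pt S.θ s x) ^ 2 / S.v s x

/-- The auxiliary function `𝔜(t) = max_{0 ≤ s ≤ t} ∫_𝕋 κ(v,θ)² θ_x² / v² dx`. -/
def Sol.Y (S : Sol μ R a b κ₁ κ₂ β γ T) (t : ℝ) : ℝ :=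
  sSup ((fun s => tInt fun x =>
    (kappa κ₁ κ₂ β (S.v s x) (S.θ s x)) ^ 2 * (px S.θ s x) ^ 2 / (S.v s x) ^ 2) ''
      Icc (0 : ℝ) t)

/-- The auxiliary function `ℨ(t) = max_{0 ≤ s ≤ t} ∫_𝕋 u_{xx}² / v² dx`. -/
def Sol.Z (S : Sol μ R a b κ₁ κ₂ β γ T) (t : ℝ) : ℝ :=
  sSup ((fun s => tInt fun x => (px (px S.u) s x) ^ 2 / (S.v s x) ^ 2) '' Icc (0 : ℝ) t)

/-- The exponent `𝔗₀(n, p, β)`. -/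
def T0 (n _p β : ℝ) : ℝ :=
  if n < (β + 3) / 2 then 4 / (n * (2 * β + 3)) else (n - β + 5) / (n * (2 * β + 3))

/-- The exponent `𝔗₁(n, β)`. -/
def T1 (n β : ℝ) : ℝ := max (T0 n 8 β) (1 / (2 * β + 3) + T0 n 1 β)

/-- The exponent `𝔘ʸ₁₁(n, β)`. -/
def Uy11 (n β : ℝ) : ℝ := 2 / (2 * β + 3) + T0 n 1 β

/-- The exponent `𝔘ᶻ₁₁(n, β)`. -/
def Uz11 (n β : ℝ) : ℝ := 3 / 4 * (1 / (1 - T0 n (5/2) β))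

/-- The exponent `𝔘ʸ₂(n, β)`. -/
def Uy2 (n β : ℝ) : ℝ := 2 / (2 * β + 3) + T1 n β

/-- The exponent `𝔘ᶻ₂(n, β)`. -/
def Uz2 (n β : ℝ) : ℝ := 3 / 4 * (1 / (1 - T0 n (3/2) β - T1 n β))

end RadHydro

open RadHydro

namespace RadHydro

section Calculus

variable {f : ℝ → ℝ → ℝ}

lemma hasDerivAt_pt (hf : ContDiff ℝ (⊤ : ℕ∞) fun p : ℝ × ℝ => f p.1 p.2) (t x : ℝ) :
    HasDerivAt (fun s => f s x) (pt f t x) t := by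
  have h : Differentiable ℝ fun s => f s x :=
    (hf.comp (contDiff_id.prodMk contDiff_const)).differentiable (by simp)
  exact (h t).hasDerivAt

lemma hasDerivAt_px (hf : ContDiff ℝ (⊤ : ℕ∞) fun p : ℝ × ℝ => f p.1 p.2) (t x : ℝ) :
    HasDerivAt (f t) (px f t x) x := by
  have h : Differentiable ℝ fun y => f t y :=
    (hf.comp (contDiff_const.prodMk contDiff_id)).differentiable (by simp)
  exact (h x).hasDerivAt

lemma contDiff_px (hf : ContDiff ℝ (⊤ : ℕ∞) fun p : ℝ × ℝ => f p.1 p.2) :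
    ContDiff ℝ (⊤ : ℕ∞) fun p : ℝ × ℝ => px f p.1 p.2 := by
  have h : (fun p : ℝ × ℝ => px f p.1 p.2) =
      fun p => fderiv ℝ (fun p : ℝ × ℝ => f p.1 p.2) p (0, 1) := by
    ext p
    refine HasDerivAt.deriv ?_
    exact ((hf.differentiable (by simp) p).hasFDerivAt).comp_hasDerivAt p.2
      ((hasDerivAt_const p.2 p.1).prodMk (hasDerivAt_id p.2))
  rw [h]
  exact (hf.fderiv_right (m := (⊤ : ℕ∞)) (by simp)).clm_apply contDiff_const

lemma contDiff_pt (hf : ContDiff ℝ (⊤ : ℕ∞) fun p : ℝ × ℝ => f p.1 p.2) :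
    ContDiff ℝ (⊤ : ℕ∞) fun p : ℝ × ℝ => pt f p.1 p.2 := by
  have h : (fun p : ℝ × ℝ => pt f p.1 p.2) =
      fun p => fderiv ℝ (fun p : ℝ × ℝ => f p.1 p.2) p (1, 0) := by
    ext p
    refine HasDerivAt.deriv ?_
    exact ((hf.differentiable (by simp) p).hasFDerivAt).comp_hasDerivAt p.1
      ((hasDerivAt_id p.1).prodMk (hasDerivAt_const p.1 p.2))
  rw [h]
  exact (hf.fderiv_right (m := (⊤ : ℕ∞)) (by simp)).clm_apply contDiff_const

lemma continuous_slice (hf : ContDiff ℝ (⊤ : ℕ∞) fun p : ℝ × ℝ => f p.1 p.2)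
    (t : ℝ) : Continuous (f t) := hf.continuous.comp (continuous_const.prodMk continuous_id)

lemma px_periodic (hf : ∀ t, Function.Periodic (f t) 1) (t : ℝ) :
    Function.Periodic (px f t) 1 := by
  intro x
  have h : (fun y => f t (y + 1)) = f t := funext (hf t)
  unfold px
  conv_rhs => rw [← h]
  rw [deriv_comp_add_const]

/-- Differentiation under the integral sign for jointly continuous data. -/
lemma hasDerivAt_intervalIntegral {f' : ℝ → ℝ → ℝ}
    (hf : Continuous fun p : ℝ × ℝ => f p.1 p.2) (hf' : Continuous fun p : ℝ × ℝ => f' p.1 p.2)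
    (h : ∀ t x, HasDerivAt (fun s => f s x) (f' t x) t) (a b t : ℝ) :
    HasDerivAt (fun s => ∫ x in a..b, f s x) (∫ x in a..b, f' t x) t := by
  have hc : ∀ s, Continuous (f s) := fun s => hf.comp (continuous_const.prodMk continuous_id)
  have hc' : ∀ s, Continuous (f' s) := fun s => hf'.comp (continuous_const.prodMk continuous_id)
  obtain ⟨C, hC⟩ := ((isCompact_closedBall t 1).prod
    (isCompact_uIcc (a := a) (b := b))).exists_bound_of_continuousOn hf'.continuousOn
  refine (intervalIntegral.hasDerivAt_integral_of_dominated_loc_of_deriv_le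
    (bound := fun _ => C) (Metric.closedBall_mem_nhds t one_pos)
    (Filter.Eventually.of_forall fun s => (hc s).aestronglyMeasurable)
    ((hc t).intervalIntegrable a b) (hc' t).aestronglyMeasurable ?_ (by simp) ?_).2
  · exact Filter.Eventually.of_forall fun x hx s hs =>
      hC (s, x) ⟨hs, uIoc_subset_uIcc hx⟩
  · exact Filter.Eventually.of_forall fun x _ s _ => h s x

/-- The mean over the torus of a conserved density is constant in time. -/
lemma tInt_eq_of_conservation {F : ℝ → ℝ → ℝ} {T : ℝ}
    (hf : ContDiff ℝ (⊤ : ℕ∞) fun p : ℝ × ℝ => f p.1 p.2)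
    (hF : ContDiff ℝ (⊤ : ℕ∞) fun p : ℝ × ℝ => F p.1 p.2)
    (hper : ∀ t, Function.Periodic (F t) 1)
    (h : ∀ t ∈ Icc (0 : ℝ) T, ∀ x, pt f t x = px F t x) :
    ∀ t ∈ Icc (0 : ℝ) T, tInt (f t) = tInt (f 0) := by
  have hd : ∀ t, HasDerivAt (fun s => tInt (f s)) (tInt (pt f t)) t := fun t =>
    hasDerivAt_intervalIntegral hf.continuous (contDiff_pt hf).continuous (hasDerivAt_pt hf) _ _ t
  refine constant_of_has_deriv_right_zero
    (fun t _ => (hd t).continuousAt.continuousWithinAt) fun t ht => ?_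
  have hz : tInt (pt f t) = 0 := by
    have : pt f t = px F t := funext (h t (Ico_subset_Icc_self ht))
    rw [this, tInt, intervalIntegral.integral_eq_sub_of_hasDerivAt
      (fun x _ => hasDerivAt_px hF t x)
      (((contDiff_px hF).continuous.comp
        (continuous_const.prodMk continuous_id)).intervalIntegrable _ _)]
    have := hper t (-(1/2))
    norm_num at this ⊢
    rw [this, sub_self]
  rw [← hz]
  exact (hd t).hasDerivWithinAt

lemma tInt_mono {f g : ℝ → ℝ} (hf : Continuous f) (hg : Continuous g)
    (h : ∀ x ∈ Icc (-(1/2) : ℝ) (1/2), f x ≤ g x) :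
    tInt f ≤ tInt g :=
  intervalIntegral.integral_mono_on (by norm_num) (hf.intervalIntegrable _ _)
    (hg.intervalIntegrable _ _) h

lemma L2sq_nonneg (f : ℝ → ℝ) : 0 ≤ L2sq f :=
  intervalIntegral.integral_nonneg (by norm_num) fun _ _ => sq_nonneg _

end Calculus

end RadHydro

namespace RadHydro

variable {μ R a b κ₁ κ₂ β γ T M ε : ℝ}

namespace Sol

variable (S : Sol μ R a b κ₁ κ₂ β γ T)

lemma tInt_v {t : ℝ} (ht : t ∈ Icc (0 : ℝ) T) : tInt (S.v t) = 1 :=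
  (tInt_eq_of_conservation S.smooth_v S.smooth_u S.periodic_u
    (fun t ht x => sub_eq_zero.1 (S.eq_mass t ht x)) t ht).trans S.mean_v

lemma contDiff_heatFlux : ContDiff ℝ (⊤ : ℕ∞) fun p : ℝ × ℝ =>
    kappa κ₁ κ₂ β (S.v p.1 p.2) (S.θ p.1 p.2) * px S.θ p.1 p.2 / S.v p.1 p.2 := by
  refine ContDiff.div (ContDiff.mul ?_ (contDiff_px S.smooth_θ)) S.smooth_v
    fun p => (S.v_pos p.1 p.2).ne'
  exact contDiff_const.add ((contDiff_const.mul S.smooth_v).mul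
    (S.smooth_θ.rpow_const_of_ne fun p => (S.θ_pos p.1 p.2).ne'))

lemma contDiff_pressure : ContDiff ℝ (⊤ : ℕ∞) fun p : ℝ × ℝ =>
    R * S.θ p.1 p.2 / S.v p.1 p.2 :=
  (contDiff_const.mul S.smooth_θ).div S.smooth_v fun p => (S.v_pos p.1 p.2).ne'

/-- Conservation of the total energy. -/
lemma tInt_energy {t : ℝ} (ht : t ∈ Icc (0 : ℝ) T) :
    tInt (fun x => R / (γ - 1) * S.θ t x + S.u t x ^ 2 / 2) =
      tInt fun x => R / (γ - 1) * S.θ 0 x + S.u 0 x ^ 2 / 2 := by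
  have hw : ContDiff ℝ (⊤ : ℕ∞) fun p : ℝ × ℝ =>
      R * S.θ p.1 p.2 / S.v p.1 p.2 * S.u p.1 p.2 := S.contDiff_pressure.mul S.smooth_u
  have hd : ContDiff ℝ (⊤ : ℕ∞) fun p : ℝ × ℝ =>
      μ * S.u p.1 p.2 * px S.u p.1 p.2 / S.v p.1 p.2 :=
    ((contDiff_const.mul S.smooth_u).mul (contDiff_px S.smooth_u)).div S.smooth_v
      fun p => (S.v_pos p.1 p.2).ne'
  have hk := S.contDiff_heatFlux
  refine tInt_eq_of_conservation
    (f := fun t x => R / (γ - 1) * S.θ t x + S.u t x ^ 2 / 2)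
    (F := fun t x => μ * S.u t x * px S.u t x / S.v t x
      + kappa κ₁ κ₂ β (S.v t x) (S.θ t x) * px S.θ t x / S.v t x
      - R * S.θ t x / S.v t x * S.u t x - S.q t x)
    ((contDiff_const.mul S.smooth_θ).add ((S.smooth_u.pow 2).div_const 2))
    (((hd.add hk).sub hw).sub S.smooth_q) (fun t x => ?_) (fun t ht x => ?_) t ht
  · simp only [S.periodic_u t x, S.periodic_v t x, S.periodic_θ t x, S.periodic_q t x,
      px_periodic S.periodic_u t x, px_periodic S.periodic_θ t x]
  · have e := S.eq_energy t ht x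
    have hd' := hasDerivAt_px (f := fun t x => μ * S.u t x * px S.u t x / S.v t x) hd t x
    have hk' := hasDerivAt_px
      (f := fun t x => kappa κ₁ κ₂ β (S.v t x) (S.θ t x) * px S.θ t x / S.v t x) hk t x
    have hw' := hasDerivAt_px (f := fun t x => R * S.θ t x / S.v t x * S.u t x) hw t x
    have := (((hd'.add hk').sub
      hw').sub (hasDerivAt_px S.smooth_q t x)).deriv
    refine Eq.trans ?_ this.symm
    linarith

/-- The effective stress `μ u_x / v - R θ / v`. -/
def stress (t x : ℝ) : ℝ := μ * px S.u t x / S.v t x - R * S.θ t x / S.v t x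

lemma contDiff_viscous : ContDiff ℝ (⊤ : ℕ∞) fun p : ℝ × ℝ =>
    μ * px S.u p.1 p.2 / S.v p.1 p.2 :=
  (contDiff_const.mul (contDiff_px S.smooth_u)).div S.smooth_v fun p => (S.v_pos p.1 p.2).ne'

lemma contDiff_stress : ContDiff ℝ (⊤ : ℕ∞) fun p : ℝ × ℝ => S.stress p.1 p.2 :=
  S.contDiff_viscous.sub S.contDiff_pressure

lemma integral_pt_u {t : ℝ} (ht : t ∈ Icc (0 : ℝ) T) (x : ℝ) :
    ∫ y in (0 : ℝ)..x, pt S.u t y = S.stress t x - S.stress t 0 := by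
  refine intervalIntegral.integral_eq_sub_of_hasDerivAt (fun y _ => ?_)
    ((continuous_slice (contDiff_pt S.smooth_u) t).intervalIntegrable _ _)
  have h := (hasDerivAt_px (f := fun t x => μ * px S.u t x / S.v t x) S.contDiff_viscous t y).sub
    (hasDerivAt_px (f := fun t x => R * S.θ t x / S.v t x) S.contDiff_pressure t y)
  have e := S.eq_mom t ht y
  exact h.congr_deriv (by linarith)

/-- The time integral of the effective stress, written through its value at `x = 0` and the
momentum accumulated on `[0, x]`. -/
def impulse (t x : ℝ) : ℝ :=
  (∫ s in (0 : ℝ)..t, S.stress s 0) + ∫ y in (0 : ℝ)..x, (S.u t y - S.u 0 y)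

lemma continuous_impulse : Continuous fun p : ℝ × ℝ => S.impulse p.1 p.2 := by
  have hs : Continuous fun s => S.stress s 0 :=
    S.contDiff_stress.continuous.comp (continuous_id.prodMk continuous_const)
  refine Continuous.add ?_ ?_
  · exact (intervalIntegral.continuous_primitive
      (fun _ _ => hs.intervalIntegrable _ _) 0).comp continuous_fst
  · refine intervalIntegral.continuous_parametric_intervalIntegral_of_continuous
      (f := fun p : ℝ × ℝ => fun y => S.u p.1 y - S.u 0 y) ?_ continuous_snd
    exact (S.smooth_u.continuous.comp
        ((continuous_fst.comp continuous_fst).prodMk continuous_snd)).sub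
      (S.smooth_u.continuous.comp (continuous_const.prodMk continuous_snd))

lemma hasDerivAt_impulse (t x : ℝ) : HasDerivAt (fun s => S.impulse s x)
    (S.stress t 0 + ∫ y in (0 : ℝ)..x, pt S.u t y) t := by
  have hs : Continuous fun s => S.stress s 0 :=
    S.contDiff_stress.continuous.comp (continuous_id.prodMk continuous_const)
  refine (hs.integral_hasStrictDerivAt 0 t).hasDerivAt.add ?_
  refine hasDerivAt_intervalIntegral (f := fun t y => S.u t y - S.u 0 y) ?_
    (contDiff_pt S.smooth_u).continuous
    (fun t x => (hasDerivAt_pt S.smooth_u t x).sub_const _) 0 x t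
  exact S.smooth_u.continuous.sub
    (S.smooth_u.continuous.comp (continuous_const.prodMk continuous_snd))

@[simp] lemma impulse_zero (x : ℝ) : S.impulse 0 x = 0 := by simp [impulse]

/-- The specific volume with the contribution of the effective stress removed. -/
def reducedVolume (t x : ℝ) : ℝ := S.v t x * exp (-S.impulse t x / μ)

lemma continuous_exp_impulse :
    Continuous fun p : ℝ × ℝ => exp (-S.impulse p.1 p.2 / μ) :=
  Real.continuous_exp.comp (S.continuous_impulse.neg.div_const μ)

/-- The time derivative of `reducedVolume`. -/
def reducedVolumeRate (t x : ℝ) : ℝ :=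
  pt S.v t x * exp (-S.impulse t x / μ) + S.v t x * (exp (-S.impulse t x / μ) *
    (-(S.stress t 0 + ∫ y in (0 : ℝ)..x, pt S.u t y) / μ))

lemma hasDerivAt_reducedVolume (t x : ℝ) :
    HasDerivAt (fun s => S.reducedVolume s x) (S.reducedVolumeRate t x) t :=
  (hasDerivAt_pt S.smooth_v t x).mul ((S.hasDerivAt_impulse t x).neg.div_const μ).exp

lemma continuous_reducedVolume : Continuous fun p : ℝ × ℝ => S.reducedVolume p.1 p.2 :=
  S.smooth_v.continuous.mul S.continuous_exp_impulse

lemma continuous_reducedVolumeRate :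
    Continuous fun p : ℝ × ℝ => S.reducedVolumeRate p.1 p.2 := by
  have hs : Continuous fun p : ℝ × ℝ => S.stress p.1 0 :=
    S.contDiff_stress.continuous.comp (continuous_fst.prodMk continuous_const)
  have hi : Continuous fun p : ℝ × ℝ => ∫ y in (0 : ℝ)..p.2, pt S.u p.1 y := by
    refine intervalIntegral.continuous_parametric_intervalIntegral_of_continuous
      (f := fun p : ℝ × ℝ => fun y => pt S.u p.1 y) ?_ continuous_snd
    exact (contDiff_pt S.smooth_u).continuous.comp
      ((continuous_fst.comp continuous_fst).prodMk continuous_snd)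
  exact ((contDiff_pt S.smooth_v).continuous.mul S.continuous_exp_impulse).add
    (S.smooth_v.continuous.mul (S.continuous_exp_impulse.mul ((hs.add hi).neg.div_const μ)))

lemma reducedVolumeRate_eq (hμ : 0 < μ) {t : ℝ} (ht : t ∈ Icc (0 : ℝ) T) (x : ℝ) :
    S.reducedVolumeRate t x = R / μ * S.θ t x * exp (-S.impulse t x / μ) := by
  rw [reducedVolumeRate, S.integral_pt_u ht, sub_eq_zero.1 (S.eq_mass t ht x), stress, stress]
  have := (S.v_pos t x).ne'
  field_simp
  ring

/-- The reduced volume is nondecreasing in time, hence bounded below by the initial volume. -/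
lemma v_zero_le_reducedVolume (hμ : 0 < μ) (hR : 0 < R) {t : ℝ} (ht : t ∈ Icc (0 : ℝ) T) (x : ℝ) :
    S.v 0 x ≤ S.reducedVolume t x := by
  have hmono : MonotoneOn (fun s => S.reducedVolume s x) (Icc 0 T) := by
    refine monotoneOn_of_deriv_nonneg (convex_Icc 0 T)
      (fun s _ => (S.hasDerivAt_reducedVolume s x).continuousAt.continuousWithinAt)
      (fun s _ => (S.hasDerivAt_reducedVolume s x).differentiableAt.differentiableWithinAt)
      fun s hs => ?_
    rw [(S.hasDerivAt_reducedVolume s x).deriv, S.reducedVolumeRate_eq hμ (interior_subset hs)]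
    have := S.θ_pos s x
    positivity
  have h := hmono (left_mem_Icc.2 (ht.1.trans ht.2)) ht ht.1
  simpa [reducedVolume] using h

/-- Bound of the initial energy in terms of the `H²` norm. -/
def energyBound (R γ M : ℝ) : ℝ := R / (γ - 1) * (1 + M ^ 2) + M ^ 2 / 2

variable {S}

lemma tInt_energy_le (hR : 0 < R) (hγ : 1 < γ) (hM : 1 ≤ M) (hS : S.Bounded M ε) {t : ℝ}
    (ht : t ∈ Icc (0 : ℝ) T) :
    tInt (fun x => R / (γ - 1) * S.θ t x + S.u t x ^ 2 / 2) ≤ energyBound R γ M := by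
  rw [S.tInt_energy ht]
  have hc : 0 < R / (γ - 1) := div_pos hR (by linarith)
  have hH : H2sq (S.v 0) + H2sq (S.u 0) + H2sq (S.θ 0) ≤ M ^ 2 := by
    have := hS.1
    rwa [Real.sqrt_le_left (by linarith)] at this
  simp only [H2sq] at hH
  have hu : L2sq (S.u 0) ≤ M ^ 2 := by
    linarith [L2sq_nonneg (S.v 0), L2sq_nonneg (S.θ 0), L2sq_nonneg (deriv (S.v 0)),
      L2sq_nonneg (deriv (S.θ 0)), L2sq_nonneg (deriv (S.u 0)),
      L2sq_nonneg (deriv (deriv (S.v 0))), L2sq_nonneg (deriv (deriv (S.u 0))),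
      L2sq_nonneg (deriv (deriv (S.θ 0)))]
  have hθ : L2sq (S.θ 0) ≤ M ^ 2 := by
    linarith [L2sq_nonneg (S.v 0), L2sq_nonneg (S.u 0), L2sq_nonneg (deriv (S.v 0)),
      L2sq_nonneg (deriv (S.θ 0)), L2sq_nonneg (deriv (S.u 0)),
      L2sq_nonneg (deriv (deriv (S.v 0))), L2sq_nonneg (deriv (deriv (S.u 0))),
      L2sq_nonneg (deriv (deriv (S.θ 0)))]
  have cu := continuous_slice S.smooth_u 0
  have cθ := continuous_slice S.smooth_θ 0
  calc tInt (fun x => R / (γ - 1) * S.θ 0 x + S.u 0 x ^ 2 / 2)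
      ≤ tInt (fun x => R / (γ - 1) * (1 + S.θ 0 x ^ 2) + S.u 0 x ^ 2 / 2) := by
        refine tInt_mono (by fun_prop) (by fun_prop) fun x _ => ?_
        gcongr
        nlinarith [sq_nonneg (S.θ 0 x - 1)]
    _ = R / (γ - 1) * (1 + L2sq (S.θ 0)) + L2sq (S.u 0) / 2 := by
        unfold L2sq tInt
        have i1 : IntervalIntegrable (fun x => S.θ 0 x ^ 2) volume (-(1/2)) (1/2) :=
          (cθ.pow 2).intervalIntegrable _ _
        have i2 : IntervalIntegrable (fun x => S.u 0 x ^ 2 / 2) volume (-(1/2)) (1/2) :=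
          ((cu.pow 2).div_const 2).intervalIntegrable _ _
        have i3 : IntervalIntegrable (fun _ : ℝ => (1 : ℝ)) volume (-(1/2)) (1/2) := by simp
        rw [intervalIntegral.integral_add ((i3.add i1).const_mul _) i2,
          intervalIntegral.integral_const_mul, intervalIntegral.integral_add i3 i1,
          intervalIntegral.integral_div]
        norm_num
    _ ≤ energyBound R γ M := by unfold energyBound; gcongr

lemma tInt_θ_le (hR : 0 < R) (hγ : 1 < γ) (hM : 1 ≤ M) (hS : S.Bounded M ε) {t : ℝ}
    (ht : t ∈ Icc (0 : ℝ) T) : R / (γ - 1) * tInt (S.θ t) ≤ energyBound R γ M := by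
  refine le_trans ?_ (tInt_energy_le hR hγ hM hS ht)
  have cu := continuous_slice S.smooth_u t
  have cθ := continuous_slice S.smooth_θ t
  rw [tInt, ← intervalIntegral.integral_const_mul]
  exact tInt_mono (by fun_prop) (by fun_prop) fun x _ => by nlinarith [sq_nonneg (S.u t x)]

lemma tInt_abs_u_le (hR : 0 < R) (hγ : 1 < γ) (hM : 1 ≤ M) (hS : S.Bounded M ε) {t : ℝ}
    (ht : t ∈ Icc (0 : ℝ) T) : tInt (fun x => |S.u t x|) ≤ 1 + energyBound R γ M := by
  have hc : 0 < R / (γ - 1) := div_pos hR (by linarith)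
  have cu := continuous_slice S.smooth_u t
  have cθ := continuous_slice S.smooth_θ t
  calc tInt (fun x => |S.u t x|)
      ≤ tInt fun x => 1 + (R / (γ - 1) * S.θ t x + S.u t x ^ 2 / 2) := by
        refine tInt_mono (by fun_prop) (by fun_prop) fun x _ => ?_
        have := mul_pos hc (S.θ_pos t x)
        nlinarith [sq_nonneg (|S.u t x| - 1), sq_abs (S.u t x)]
    _ = 1 + tInt fun x => R / (γ - 1) * S.θ t x + S.u t x ^ 2 / 2 := by
        unfold tInt
        rw [intervalIntegral.integral_add (by simp)
          (Continuous.intervalIntegrable (by fun_prop) _ _)]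
        norm_num
    _ ≤ _ := by gcongr; exact tInt_energy_le hR hγ hM hS ht

lemma abs_integral_u_sub_le (hR : 0 < R) (hγ : 1 < γ) (hM : 1 ≤ M) (hS : S.Bounded M ε) {t : ℝ}
    (ht : t ∈ Icc (0 : ℝ) T) {x : ℝ} (hx : x ∈ Icc (-(1/2) : ℝ) (1/2)) :
    |∫ y in (0 : ℝ)..x, (S.u t y - S.u 0 y)| ≤ 2 * (1 + energyBound R γ M) := by
  have cu := continuous_slice S.smooth_u t
  have cu0 := continuous_slice S.smooth_u 0
  have hsub : uIoc (0 : ℝ) x ⊆ uIoc (-(1/2) : ℝ) (1/2) := by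
    rw [uIoc_of_le (by norm_num : (-(1/2) : ℝ) ≤ 1/2)]
    exact Ioc_subset_Ioc (le_min (by norm_num) hx.1) (max_le (by norm_num) hx.2)
  calc |∫ y in (0 : ℝ)..x, (S.u t y - S.u 0 y)|
      ≤ |∫ y in (0 : ℝ)..x, (|S.u t y| + |S.u 0 y|)| := by
        refine intervalIntegral.norm_integral_le_abs_of_norm_le
          (f := fun y => S.u t y - S.u 0 y) (g := fun y => |S.u t y| + |S.u 0 y|)
          (Filter.Eventually.of_forall fun y => abs_sub (S.u t y) (S.u 0 y))
          (Continuous.intervalIntegrable (by fun_prop) _ _)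
    _ ≤ |∫ y in (-(1/2) : ℝ)..(1/2), (|S.u t y| + |S.u 0 y|)| :=
        intervalIntegral.abs_integral_mono_interval hsub
          (Filter.Eventually.of_forall fun y => add_nonneg (abs_nonneg _) (abs_nonneg _))
          (Continuous.intervalIntegrable (by fun_prop) _ _)
    _ = tInt (fun y => |S.u t y|) + tInt fun y => |S.u 0 y| := by
        rw [abs_of_nonneg (intervalIntegral.integral_nonneg (by norm_num)
          fun y _ => add_nonneg (abs_nonneg _) (abs_nonneg _)),
          intervalIntegral.integral_add (cu.abs.intervalIntegrable _ _)
            (cu0.abs.intervalIntegrable _ _)]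
        rfl
    _ ≤ _ := by
        linarith [tInt_abs_u_le hR hγ hM hS ht,
          tInt_abs_u_le hR hγ hM hS (left_mem_Icc.2 (ht.1.trans ht.2))]

end Sol

end RadHydro

namespace RadHydro

namespace Sol

variable {μ R a b κ₁ κ₂ β γ T M ε : ℝ} {S : Sol μ R a b κ₁ κ₂ β γ T}

/-- The factor controlling the variation of `exp (-impulse / μ)` over one period. -/
def spatialFactor (μ R γ M : ℝ) : ℝ := exp (2 * (1 + energyBound R γ M) / μ)

lemma exp_impulse_bounds (hμ : 0 < μ) (hR : 0 < R) (hγ : 1 < γ) (hM : 1 ≤ M)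
    (hS : S.Bounded M ε) {t : ℝ} (ht : t ∈ Icc (0 : ℝ) T) {x : ℝ}
    (hx : x ∈ Icc (-(1/2) : ℝ) (1/2)) :
    exp (-S.impulse t x / μ) ≤ spatialFactor μ R γ M * exp (-S.impulse t 0 / μ) ∧
      exp (-S.impulse t 0 / μ) ≤ spatialFactor μ R γ M * exp (-S.impulse t x / μ) := by
  have h := abs_le.1 (abs_integral_u_sub_le hR hγ hM hS ht hx)
  have e : S.impulse t x = S.impulse t 0 + ∫ y in (0 : ℝ)..x, (S.u t y - S.u 0 y) := by
    simp [impulse]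
  rw [spatialFactor, ← exp_add, ← exp_add, exp_le_exp, exp_le_exp, ← add_div, ← add_div,
    div_le_div_iff_of_pos_right hμ, div_le_div_iff_of_pos_right hμ]
  constructor <;> linarith

/-- The growth rate in the Grönwall estimate for the mean of the reduced volume. -/
def growthRate (μ R γ M : ℝ) : ℝ :=
  (γ - 1) * energyBound R γ M / μ * spatialFactor μ R γ M ^ 2

lemma exp_impulse_zero_le_tInt (hμ : 0 < μ) (hR : 0 < R) (hγ : 1 < γ) (hM : 1 ≤ M)
    (hS : S.Bounded M ε) {t : ℝ} (ht : t ∈ Icc (0 : ℝ) T) :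
    exp (-S.impulse t 0 / μ) ≤ spatialFactor μ R γ M * tInt (S.reducedVolume t) := by
  have cv := continuous_slice S.smooth_v t
  have cw : Continuous (S.reducedVolume t) :=
    S.continuous_reducedVolume.comp (continuous_const.prodMk continuous_id)
  calc exp (-S.impulse t 0 / μ) = tInt fun x => exp (-S.impulse t 0 / μ) * S.v t x := by
        rw [tInt, intervalIntegral.integral_const_mul]
        change _ = _ * tInt (S.v t)
        rw [S.tInt_v ht, mul_one]
    _ ≤ tInt fun x => spatialFactor μ R γ M * S.reducedVolume t x := by
        refine tInt_mono (by fun_prop) (by fun_prop) fun x hx => ?_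
        have := mul_le_mul_of_nonneg_right
          (exp_impulse_bounds hμ hR hγ hM hS ht hx).2 (S.v_pos t x).le
        exact this.trans_eq (by rw [reducedVolume]; ring)
    _ = _ := intervalIntegral.integral_const_mul _ _

lemma tInt_reducedVolumeRate_le (hμ : 0 < μ) (hR : 0 < R) (hγ : 1 < γ) (hM : 1 ≤ M)
    (hS : S.Bounded M ε) {t : ℝ} (ht : t ∈ Icc (0 : ℝ) T) :
    tInt (S.reducedVolumeRate t) ≤ growthRate μ R γ M * tInt (S.reducedVolume t) := by
  have cθ := continuous_slice S.smooth_θ t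
  have cr : Continuous (S.reducedVolumeRate t) :=
    S.continuous_reducedVolumeRate.comp (continuous_const.prodMk continuous_id)
  set K := spatialFactor μ R γ M with hK
  set A := exp (-S.impulse t 0 / μ) with hA
  have hKpos : 0 < K := exp_pos _
  have hApos : 0 < A := exp_pos _
  have hγ' : 0 < γ - 1 := by linarith
  have hθ := tInt_θ_le hR hγ hM hS ht
  have hθpos : 0 ≤ tInt (S.θ t) :=
    intervalIntegral.integral_nonneg (by norm_num) fun x _ => (S.θ_pos t x).le
  have hRθ : R * tInt (S.θ t) ≤ (γ - 1) * energyBound R γ M := by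
    have := mul_le_mul_of_nonneg_left hθ hγ'.le
    rwa [← mul_assoc, mul_div_cancel₀ _ hγ'.ne'] at this
  have hE : 0 ≤ (γ - 1) * energyBound R γ M := (mul_nonneg hR.le hθpos).trans hRθ
  calc tInt (S.reducedVolumeRate t) ≤ tInt fun x => R / μ * (K * A) * S.θ t x := by
        refine tInt_mono cr (by fun_prop) fun x hx => ?_
        rw [S.reducedVolumeRate_eq hμ ht x]
        have h1 := (exp_impulse_bounds hμ hR hγ hM hS ht hx).1
        have h2 : 0 ≤ R / μ * S.θ t x := mul_nonneg (by positivity) (S.θ_pos t x).le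
        exact (mul_le_mul_of_nonneg_left h1 h2).trans_eq (by ring)
    _ = R * tInt (S.θ t) / μ * (K * A) := by
        rw [tInt, intervalIntegral.integral_const_mul, tInt]; ring
    _ ≤ (γ - 1) * energyBound R γ M / μ * (K * (K * tInt (S.reducedVolume t))) := by
        gcongr
        exact exp_impulse_zero_le_tInt hμ hR hγ hM hS ht
    _ = _ := by rw [growthRate]; ring

lemma tInt_reducedVolume_le (hμ : 0 < μ) (hR : 0 < R) (hγ : 1 < γ) (hM : 1 ≤ M)
    (hS : S.Bounded M ε) {t : ℝ} (ht : t ∈ Icc (0 : ℝ) T) :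
    tInt (S.reducedVolume t) ≤ exp (growthRate μ R γ M * t) := by
  have hd : ∀ t, HasDerivAt (fun s => tInt (S.reducedVolume s))
      (tInt (S.reducedVolumeRate t)) t := fun t =>
    hasDerivAt_intervalIntegral S.continuous_reducedVolume S.continuous_reducedVolumeRate
      S.hasDerivAt_reducedVolume _ _ t
  have h0 : tInt (S.reducedVolume 0) = 1 := by
    have : S.reducedVolume 0 = S.v 0 := by ext x; simp [reducedVolume]
    rw [this, S.mean_v]
  have h := le_gronwallBound_of_liminf_deriv_right_le (δ := 1) (K := growthRate μ R γ M) (ε := 0)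
    (fun s _ => (hd s).continuousAt.continuousWithinAt)
    (fun s _ r hr => (hd s).hasDerivWithinAt.liminf_right_slope_le hr) h0.le
    (fun s hs => by
      rw [add_zero]
      exact tInt_reducedVolumeRate_le hμ hR hγ hM hS (Ico_subset_Icc_self hs)) t ht
  simpa [gronwallBound_ε0] using h

lemma exp_impulse_le (hμ : 0 < μ) (hR : 0 < R) (hγ : 1 < γ) (hM : 1 ≤ M)
    (hS : S.Bounded M ε) {t : ℝ} (ht : t ∈ Icc (0 : ℝ) T) {x : ℝ}
    (hx : x ∈ Icc (-(1/2) : ℝ) (1/2)) :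
    exp (-S.impulse t x / μ) ≤
      spatialFactor μ R γ M ^ 2 * exp (growthRate μ R γ M * t) := by
  have hK : 0 < spatialFactor μ R γ M := exp_pos _
  calc exp (-S.impulse t x / μ)
      ≤ spatialFactor μ R γ M * exp (-S.impulse t 0 / μ) :=
        (exp_impulse_bounds hμ hR hγ hM hS ht hx).1
    _ ≤ spatialFactor μ R γ M * (spatialFactor μ R γ M * exp (growthRate μ R γ M * t)) := by
        gcongr
        refine (exp_impulse_zero_le_tInt hμ hR hγ hM hS ht).trans ?_
        gcongr
        exact tInt_reducedVolume_le hμ hR hγ hM hS ht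
    _ = _ := by ring

end Sol

lemma growthRate_nonneg {μ R γ M : ℝ} (hμ : 0 < μ) (hR : 0 < R) (hγ : 1 < γ) :
    0 ≤ Sol.growthRate μ R γ M := by
  have hγ' : 0 < γ - 1 := by linarith
  unfold Sol.growthRate Sol.energyBound
  positivity

end RadHydro

theorem stmt_3 (μ R a b κ₁ κ₂ β γ : ℝ)
    (hμ : 0 < μ) (hR : 0 < R) (ha : 0 < a) (hb : 0 < b)
    (hκ₁ : 0 < κ₁) (hκ₂ : 0 < κ₂) (hβ : 0 < β) (hγ : 1 < γ)
    (T M ε : ℝ) (hT : 0 < T) (hM : 1 ≤ M) (hε0 : 0 < ε) (hε1 : ε ≤ 1) :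
    ∃ C : ℝ, 0 < C ∧
      ∀ S : Sol μ R a b κ₁ κ₂ β γ T, S.Bounded M ε →
        ∀ t ∈ Icc (0 : ℝ) T,
          ∀ x : ℝ, C ≤ S.v t x := by
  set K := Sol.spatialFactor μ R γ M ^ 2 * exp (Sol.growthRate μ R γ M * T) with hK
  have hKpos : 0 < K := mul_pos (pow_pos (exp_pos _) 2) (exp_pos _)
  refine ⟨ε / K, div_pos hε0 hKpos, fun S hS t ht x => ?_⟩
  have hx : x - round x ∈ Icc (-(1/2) : ℝ) (1/2) := abs_le.1 (abs_sub_round x)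
  have hper : S.v t (x - round x) = S.v t x := by
    simpa using (S.periodic_v t).sub_int_mul_eq (round x) (x := x)
  rw [← hper, div_le_iff₀ hKpos]
  have h1 := (hS.2.1 _).trans (S.v_zero_le_reducedVolume hμ hR ht (x - round x))
  refine h1.trans (mul_le_mul_of_nonneg_left ?_ (S.v_pos t _).le)
  refine (Sol.exp_impulse_le hμ hR hγ hM hS ht hx).trans ?_
  have := growthRate_nonneg (M := M) hμ hR hγ
  rw [hK]
  gcongr
  exact ht.2
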